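/- For all natural numbers n and all a, b, x ∈ R: Σ_{k=0}^{n} [n,k]_q · a^{n−k} · ∏_{i=0}^{k−1}(x + q^i·b) = Σ_{k=0}^{n} [n,k]_q · x^{n−k} · ∏_{i=0}^{k−1}(a + q^i·b). -/

import Mathlib

/-- The Gaussian (`q`-binomial) coefficient `[n, k]_q`, defined by the recurrence
`[n, 0]_q = 1`, `[0, k+1]_q = 0`, `[n+1, k+1]_q = [n, k]_q + q^(k+1) * [n, k+1]_q`
(so that `[n+1, k]_q = [n, k-1]_q + q^k * [n, k]_q` and `[n, k]_q = 0` for `k > n`). -/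
def qBinom {R : Type*} [CommRing R] (q : R) : ℕ → ℕ → R
  | _, 0 => 1
  | 0, _ + 1 => 0
  | n + 1, k + 1 => qBinom q n k + q ^ (k + 1) * qBinom q n (k + 1)

theorem qBinom_zero_right {R : Type*} [CommRing R] (q : R) (n : ℕ) : qBinom q n 0 = 1 := by
  cases n <;> rfl

theorem qBinom_succ_succ {R : Type*} [CommRing R] (q : R) (n k : ℕ) :
    qBinom q (n + 1) (k + 1) = qBinom q n k + q ^ (k + 1) * qBinom q n (k + 1) := rfl

theorem qBinom_eq_zero_of_lt {R : Type*} [CommRing R] (q : R) {n k : ℕ} (h : n < k) :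
    qBinom q n k = 0 := by
  induction n generalizing k with
  | zero =>
    obtain ⟨k, rfl⟩ := Nat.exists_eq_succ_of_ne_zero h.ne'
    rfl
  | succ n ih =>
    obtain ⟨k, rfl⟩ := Nat.exists_eq_succ_of_ne_zero (Nat.ne_zero_of_lt h)
    rw [Nat.succ_eq_add_one, qBinom_succ_succ, ih (by omega), ih (by omega)]
    ring

theorem pow_sub_one_mul_qBinom {R : Type*} [CommRing R] (q : R) {n k : ℕ} (h : k ≤ n) :
    (q ^ (n - k) - 1) * qBinom q n k = (q ^ (k + 1) - 1) * qBinom q n (k + 1) := by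
  induction n generalizing k with
  | zero =>
    obtain rfl : k = 0 := by omega
    simp [qBinom]
  | succ n ih =>
    cases k with
    | zero =>
      have h0 := ih (Nat.zero_le n)
      simp only [qBinom_zero_right, qBinom_succ_succ, Nat.sub_zero] at h0 ⊢
      linear_combination q * h0
    | succ k =>
      obtain rfl | hlt : k = n ∨ k < n := by omega
      · simp [qBinom_eq_zero_of_lt q (Nat.lt_succ_self (k + 1))]
      · obtain ⟨m, rfl⟩ := Nat.exists_eq_add_of_lt hlt
        have h1 := ih (k := k) (by omega)
        have h2 := ih (k := k + 1) (by omega)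
        rw [show k + m + 1 - k = m + 1 by omega] at h1
        rw [show k + m + 1 - (k + 1) = m by omega] at h2
        rw [show k + m + 1 + 1 - (k + 1) = m + 1 by omega, qBinom_succ_succ,
          qBinom_succ_succ q _ (k + 1)]
        linear_combination h1 + q ^ (k + 2) * h2

theorem qBinom_succ_succ' {R : Type*} [CommRing R] (q : R) {n k : ℕ} (h : k ≤ n) :
    qBinom q (n + 1) (k + 1) = q ^ (n - k) * qBinom q n k + qBinom q n (k + 1) := by
  rw [qBinom_succ_succ]
  linear_combination -pow_sub_one_mul_qBinom q h

theorem one_sub_pow_mul_qBinom_succ {R : Type*} [CommRing R] (q : R) {n k : ℕ}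
    (h : k ≤ n) :
    (1 - q ^ (n + 1 - k)) * qBinom q (n + 1) k = (1 - q ^ (n + 1)) * qBinom q n k := by
  cases k with
  | zero => simp [qBinom_zero_right]
  | succ k =>
    obtain ⟨m, rfl⟩ := Nat.exists_eq_add_of_le h
    have h1 := pow_sub_one_mul_qBinom q (show k ≤ k + 1 + m by omega)
    rw [show k + 1 + m - k = m + 1 by omega] at h1
    rw [show k + 1 + m + 1 - (k + 1) = m + 1 by omega, qBinom_succ_succ]
    linear_combination -h1

/-- The sum `∑ k ≤ n, [n, k]_q a^(n-k) ∏ i < k, (x + q^i b)`. -/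
def qBinomSum {R : Type*} [CommRing R] (q a b x : R) (n : ℕ) : R :=
  ∑ k ∈ Finset.range (n + 1),
    qBinom q n k * a ^ (n - k) * ∏ i ∈ Finset.range k, (x + q ^ i * b)

theorem qBinomSum_mul_left {R : Type*} [CommRing R] (q a b x : R) (n : ℕ) :
    ∑ k ∈ Finset.range (n + 1),
        q ^ (n + 1 - (k + 1)) * (qBinom q n k * a ^ (n - k) *
          ∏ i ∈ Finset.range (k + 1), (x + q ^ i * b)) =
      x * (∑ k ∈ Finset.range (n + 1), q ^ (n - k) * (qBinom q n k * a ^ (n - k) *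
          ∏ i ∈ Finset.range k, (x + q ^ i * b))) + q ^ n * b * qBinomSum q a b x n := by
  rw [qBinomSum, Finset.mul_sum, Finset.mul_sum, ← Finset.sum_add_distrib]
  refine Finset.sum_congr rfl fun k hk => ?_
  obtain ⟨m, rfl⟩ := Nat.exists_eq_add_of_le (Finset.mem_range_succ_iff.mp hk)
  rw [Finset.prod_range_succ, Nat.add_sub_add_right, Nat.add_sub_cancel_left]
  ring

theorem qBinomSum_succ {R : Type*} [CommRing R] (q a b x : R) (n : ℕ) :
    qBinomSum q a b x (n + 1) = (a + q ^ n * b) * qBinomSum q a b x n +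
      x * ∑ k ∈ Finset.range (n + 1), q ^ (n - k) * (qBinom q n k * a ^ (n - k) *
        ∏ i ∈ Finset.range k, (x + q ^ i * b)) := by
  have hsplit : qBinomSum q a b x (n + 1) =
      ∑ k ∈ Finset.range (n + 1), q ^ (n + 1 - (k + 1)) * (qBinom q n k * a ^ (n - k) *
          ∏ i ∈ Finset.range (k + 1), (x + q ^ i * b)) +
        ∑ k ∈ Finset.range (n + 2), qBinom q n k * a ^ (n + 1 - k) *
          ∏ i ∈ Finset.range k, (x + q ^ i * b) := by
    rw [qBinomSum, Finset.sum_range_succ', Finset.sum_range_succ' _ (n + 1), ← add_assoc,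
      ← Finset.sum_add_distrib, qBinom_zero_right, qBinom_zero_right]
    congr 1
    refine Finset.sum_congr rfl fun k hk => ?_
    rw [qBinom_succ_succ' q (Finset.mem_range_succ_iff.mp hk), Nat.add_sub_add_right]
    ring
  have hlow : ∑ k ∈ Finset.range (n + 2), qBinom q n k * a ^ (n + 1 - k) *
      ∏ i ∈ Finset.range k, (x + q ^ i * b) = a * qBinomSum q a b x n := by
    rw [Finset.sum_range_succ, qBinom_eq_zero_of_lt q (Nat.lt_succ_self n), zero_mul, zero_mul,
      add_zero, qBinomSum, Finset.mul_sum]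
    refine Finset.sum_congr rfl fun k hk => ?_
    rw [Nat.succ_sub (Finset.mem_range_succ_iff.mp hk), pow_succ]
    ring
  rw [hsplit, hlow, qBinomSum_mul_left]
  ring

theorem sum_pow_mul_qBinom_succ {R : Type*} [CommRing R] (q a b x : R) (n : ℕ) :
    ∑ k ∈ Finset.range (n + 2), q ^ (n + 1 - k) * (qBinom q (n + 1) k * a ^ (n + 1 - k) *
        ∏ i ∈ Finset.range k, (x + q ^ i * b)) =
      qBinomSum q a b x (n + 1) - a * (1 - q ^ (n + 1)) * qBinomSum q a b x n := by
  rw [eq_sub_iff_add_eq, qBinomSum, qBinomSum, Finset.sum_range_succ,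
    Finset.sum_range_succ _ (n + 1), Finset.mul_sum, add_right_comm, ← Finset.sum_add_distrib,
    Nat.sub_self, pow_zero, one_mul]
  congr 1
  refine Finset.sum_congr rfl fun k hk => ?_
  have hle := Finset.mem_range_succ_iff.mp hk
  have h := one_sub_pow_mul_qBinom_succ q hle
  have ha : a ^ (n + 1 - k) = a ^ (n - k) * a := by rw [Nat.succ_sub hle, pow_succ]
  rw [ha]
  linear_combination -(a ^ (n - k) * a * ∏ i ∈ Finset.range k, (x + q ^ i * b)) * h

/-- A three-term recurrence whose coefficients are symmetric in `a` and `x`. -/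
theorem qBinomSum_add_two {R : Type*} [CommRing R] (q a b x : R) (n : ℕ) :
    qBinomSum q a b x (n + 2) = (a + x + q ^ (n + 1) * b) * qBinomSum q a b x (n + 1) -
      a * x * (1 - q ^ (n + 1)) * qBinomSum q a b x n := by
  rw [qBinomSum_succ, sum_pow_mul_qBinom_succ]
  ring

theorem qBinomSum_comm {R : Type*} [CommRing R] (q a b x : R) (n : ℕ) :
    qBinomSum q a b x n = qBinomSum q x b a n := by
  induction n using Nat.twoStepInduction with
  | zero => simp [qBinomSum]
  | one =>
    simp [qBinomSum, Finset.sum_range_succ, qBinom]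
    ring
  | more n h0 h1 =>
    rw [qBinomSum_add_two, qBinomSum_add_two, h0, h1]
    ring

/-- Identity (3.7):
`∑_{k=0}^{n} [n,k]_q a^{n-k} (x ∔ b)^k = ∑_{k=0}^{n} [n,k]_q x^{n-k} (a ∔ b)^k`,
where `(u ∔ v)^k := ∏_{i=0}^{k-1} (u + q^i v)`. -/
theorem qBinom_symm_identity {R : Type*} [CommRing R] (q : R) (n : ℕ) (a b x : R) :
    ∑ k ∈ Finset.range (n + 1),
        qBinom q n k * a ^ (n - k) * ∏ i ∈ Finset.range k, (x + q ^ i * b) =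
      ∑ k ∈ Finset.range (n + 1),
        qBinom q n k * x ^ (n - k) * ∏ i ∈ Finset.range k, (a + q ^ i * b) := by
  exact qBinomSum_comm q a b x n
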